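/- For an integer m×n matrix A, the following are equivalent: (a) the rows of A form a ℤ-generating set for a subspace; (b) the columns of A form a ℤ-generating set for a subspace; (c) whenever u ∈ ℝᵐ and x ∈ ℝⁿ satisfy uᵀA ∈ ℤⁿ and Ax ∈ ℤᵐ, then uᵀAx ∈ ℤ. -/

import Mathlib

/-- The rows of the integer matrix `A` form a `ℤ`-generating set for a subspace. -/
def rowsZGSS {m n : ℕ} (A : Matrix (Fin m) (Fin n) ℤ) : Prop :=
  ∀ w : Fin n → ℤ, (∃ u : Fin m → ℝ, ∀ j, (w j : ℝ) = ∑ i, u i * (A i j : ℝ)) →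
    ∃ u : Fin m → ℤ, ∀ j, w j = ∑ i, u i * A i j

/-- The columns of the integer matrix `A` form a `ℤ`-generating set for a subspace. -/
def colsZGSS {m n : ℕ} (A : Matrix (Fin m) (Fin n) ℤ) : Prop :=
  ∀ b : Fin m → ℤ, (∃ x : Fin n → ℝ, ∀ i, (b i : ℝ) = ∑ j, (A i j : ℝ) * x j) →
    ∃ x : Fin n → ℤ, ∀ i, b i = ∑ j, A i j * x j

/-- Integer Farkas lemma, via characters of the quotient of `ℤ^m` by the column lattice. -/
theorem int_farkas {m n : ℕ} (A : Matrix (Fin m) (Fin n) ℤ) (b : Fin m → ℤ)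
    (h : ∀ u : Fin m → ℝ, (∀ j, ∃ z : ℤ, ∑ i, u i * (A i j : ℝ) = (z : ℝ)) →
      ∃ z : ℤ, ∑ i, u i * (b i : ℝ) = (z : ℝ)) :
    ∃ x : Fin n → ℤ, ∀ i, b i = ∑ j, A i j * x j := by
  by_contra hb
  let L : Submodule ℤ (Fin m → ℤ) := LinearMap.range A.mulVecLin
  have hbL : b ∉ L := by
    rintro ⟨x, hx⟩
    exact hb ⟨x, fun i => by rw [← hx]; rfl⟩
  have hq : (L.mkQ b) ≠ 0 := by
    simpa [Submodule.Quotient.mk_eq_zero] using hbL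
  obtain ⟨c, hc⟩ := CharacterModule.exists_character_apply_ne_zero_of_ne_zero hq
  let φ : (Fin m → ℤ) →+ AddCircle (1 : ℚ) := c.comp L.mkQ.toAddMonoidHom
  choose u hu using fun i => QuotientAddGroup.mk_surjective (φ (Pi.single i 1))
  have key : ∀ v : Fin m → ℤ, φ v = ((∑ i, u i * (v i : ℚ) : ℚ) : AddCircle (1 : ℚ)) := by
    intro v
    have hv : v = ∑ i, v i • (Pi.single i 1 : Fin m → ℤ) := by
      ext k
      simp [Finset.sum_apply, Pi.single_apply]
    have h2 : ((∑ i, u i * (v i : ℚ) : ℚ) : AddCircle (1 : ℚ))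
        = ∑ i, v i • ((u i : ℚ) : AddCircle (1 : ℚ)) := by
      have : (∑ i, u i * (v i : ℚ) : ℚ) = ∑ i, v i • u i := by
        simp [mul_comm]
      rw [this]
      exact map_sum (QuotientAddGroup.mk' (AddSubgroup.zmultiples (1 : ℚ))) _ _
    rw [h2]
    conv_lhs => rw [hv]
    rw [map_sum]
    refine Finset.sum_congr rfl fun i _ => ?_
    rw [map_zsmul, ← hu i]
  have key2 : ∀ v : Fin m → ℤ, φ v = 0 ↔ ∃ z : ℤ, ∑ i, (u i : ℝ) * (v i : ℝ) = (z : ℝ) := by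
    intro v
    rw [key, AddCircle.coe_eq_zero_iff]
    refine exists_congr fun z => ?_
    rw [zsmul_eq_mul, mul_one, eq_comm]
    exact_mod_cast Iff.rfl
  apply hc
  refine (key2 b).2 (h (fun i => (u i : ℝ)) fun j => (key2 fun i => A i j).1 ?_)
  have : (fun i => A i j) ∈ L := ⟨Pi.single j 1, by ext i; simp⟩
  change c (L.mkQ _) = 0
  rw [Submodule.mkQ_apply, (Submodule.Quotient.mk_eq_zero L).2 this, map_zero]

theorem cols_iff {m n : ℕ} (A : Matrix (Fin m) (Fin n) ℤ) :
    colsZGSS A ↔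
      ∀ (u : Fin m → ℝ) (x : Fin n → ℝ),
        (∀ j, ∃ z : ℤ, ∑ i, u i * (A i j : ℝ) = (z : ℝ)) →
        (∀ i, ∃ z : ℤ, ∑ j, (A i j : ℝ) * x j = (z : ℝ)) →
        ∃ z : ℤ, ∑ i, ∑ j, u i * (A i j : ℝ) * x j = (z : ℝ) := by
  constructor
  · intro h u x hu hx
    choose b hb using hx
    choose w hw using hu
    obtain ⟨y, hy⟩ := h b ⟨x, fun i => (hb i).symm⟩
    refine ⟨∑ j, w j * y j, ?_⟩
    calc ∑ i, ∑ j, u i * (A i j : ℝ) * x j = ∑ i, u i * (b i : ℝ) := by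
          refine Finset.sum_congr rfl fun i _ => ?_
          rw [← hb i, Finset.mul_sum]
          exact Finset.sum_congr rfl fun j _ => mul_assoc _ _ _
      _ = ∑ i, ∑ j, u i * (A i j : ℝ) * (y j : ℝ) := by
          refine Finset.sum_congr rfl fun i _ => ?_
          rw [hy i]
          push_cast
          rw [Finset.mul_sum]
          exact Finset.sum_congr rfl fun j _ => (mul_assoc _ _ _).symm
      _ = _ := by
          rw [Finset.sum_comm]
          push_cast
          refine Finset.sum_congr rfl fun j _ => ?_
          rw [← hw j, Finset.sum_mul]
  · rintro h b ⟨x, hx⟩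
    refine int_farkas A b fun u hu => ?_
    obtain ⟨z, hz⟩ := h u x hu fun i => ⟨b i, (hx i).symm⟩
    refine ⟨z, hz ▸ Finset.sum_congr rfl fun i _ => ?_⟩
    rw [hx i, Finset.mul_sum]
    exact Finset.sum_congr rfl fun j _ => (mul_assoc _ _ _).symm

theorem rows_iff_transpose {m n : ℕ} (A : Matrix (Fin m) (Fin n) ℤ) :
    rowsZGSS A ↔ colsZGSS A.transpose := by
  simp only [rowsZGSS, colsZGSS, Matrix.transpose_apply, mul_comm]

/-- (a) rows form a `ℤ`-GSS ↔ (b) columns form a `ℤ`-GSS ↔ (c) whenever `uᵀA` and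
`Ax` are integral, `uᵀAx` is an integer. -/
theorem ZGSS_tfae {m n : ℕ} (A : Matrix (Fin m) (Fin n) ℤ) :
    (rowsZGSS A ↔ colsZGSS A) ∧
    (colsZGSS A ↔
      ∀ (u : Fin m → ℝ) (x : Fin n → ℝ),
        (∀ j, ∃ z : ℤ, ∑ i, u i * (A i j : ℝ) = (z : ℝ)) →
        (∀ i, ∃ z : ℤ, ∑ j, (A i j : ℝ) * x j = (z : ℝ)) →
        ∃ z : ℤ, ∑ i, ∑ j, u i * (A i j : ℝ) * x j = (z : ℝ)) := by
  refine ⟨?_, cols_iff A⟩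
  rw [rows_iff_transpose, cols_iff, cols_iff]
  have e : ∀ (u : Fin m → ℝ) (x : Fin n → ℝ),
      ∑ j, ∑ i, x j * (A i j : ℝ) * u i = ∑ i, ∑ j, u i * (A i j : ℝ) * x j := by
    intro u x
    rw [Finset.sum_comm]
    exact Finset.sum_congr rfl fun i _ => Finset.sum_congr rfl fun j _ => by ring
  constructor
  · intro h u x hu hx
    rw [← e]
    refine h x u (fun i => ?_) (fun j => ?_)
    · simpa only [Matrix.transpose_apply, mul_comm] using hx i
    · simpa only [Matrix.transpose_apply, mul_comm] using hu j
  · intro h x u hx hu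
    simp only [Matrix.transpose_apply] at hx hu ⊢
    rw [e]
    refine h u x (fun j => ?_) (fun i => ?_)
    · simpa only [mul_comm] using hu j
    · simpa only [mul_comm] using hx i
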